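/- Let n ≥ 2 be an integer and let f : ℝⁿ → ℝ be continuous and Lebesgue integrable with α := ∫_{ℝⁿ} max(f,0) dx < c_n and β := ∫_{ℝⁿ} max(−f,0) dx < ∞, such that y ↦ log(|y|/|x−y|) f(y) is Lebesgue integrable for every x ∈ ℝⁿ. Set u(x) := (1/c_n) ∫_{ℝⁿ} log(|y|/|x−y|) f(y) dy. Then the weight ω := e^{n u} is a strong A∞ weight on ℝⁿ: there exist p > 1, K and C, all depending only on n, α and β, such that ω is an A_p weight with constant K and C^{−1} δ_ω(x,y) ≤ d_ω(x,y) ≤ C δ_ω(x,y) for all x, y ∈ ℝⁿ. -/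

import Mathlib

open MeasureTheory Metric Set
open scoped ENNReal

/-- `c_n := 2^{n-2} Γ(n/2) π^{n/2}`. -/
noncomputable def cN (n : ℕ) : ℝ :=
  (2 : ℝ) ^ ((n : ℝ) - 2) * Real.Gamma ((n : ℝ) / 2) * Real.pi ^ ((n : ℝ) / 2)

/-- Logarithmic potential `u(x) = (1/c_n) ∫ log(|y|/|x-y|) f(y) dy`. -/
noncomputable def logPot (n : ℕ) (f : EuclideanSpace ℝ (Fin n) → ℝ)
    (x : EuclideanSpace ℝ (Fin n)) : ℝ :=
  (1 / cN n) * ∫ y, Real.log (‖y‖ / ‖x - y‖) * f y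

/-- `ω` is an `A_p` weight with constant `K` (for `p > 1`):
for every ball `B`, `(⨍_B ω) · (⨍_B ω^{-1/(p-1)})^{p-1} ≤ K`. -/
def IsApWeight (n : ℕ) (p K : ℝ) (ω : EuclideanSpace ℝ (Fin n) → ℝ) : Prop :=
  ∀ (x : EuclideanSpace ℝ (Fin n)) (r : ℝ), 0 < r →
    ((volume (ball x r)).toReal⁻¹ * ∫ y in ball x r, ω y) *
      ((volume (ball x r)).toReal⁻¹ *
        ∫ y in ball x r, (ω y) ^ (-(1 / (p - 1)) : ℝ)) ^ (p - 1) ≤ K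

/-- `δ_ω(x,y) = (∫_{B_{xy}} ω)^{1/n}`, where `B_{xy}` is the closed ball with
center `(x+y)/2` and radius `|x-y|/2`. -/
noncomputable def deltaW (n : ℕ) (ω : EuclideanSpace ℝ (Fin n) → ℝ)
    (x y : EuclideanSpace ℝ (Fin n)) : ℝ :=
  (∫ z in closedBall (midpoint ℝ x y) (dist x y / 2), ω z) ^ ((1 : ℝ) / n)

/-- `d_ω(x,y)`: infimum of `∫₀^L ω(γ(t))^{1/n} dt` over all `L ≥ 0` and all
1-Lipschitz curves `γ : [0,L] → ℝⁿ` joining `x` to `y` inside `B_{xy}`. -/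
noncomputable def dW (n : ℕ) (ω : EuclideanSpace ℝ (Fin n) → ℝ)
    (x y : EuclideanSpace ℝ (Fin n)) : ℝ :=
  sInf {d : ℝ | ∃ (L : ℝ) (γ : ℝ → EuclideanSpace ℝ (Fin n)),
    0 ≤ L ∧ LipschitzOnWith 1 γ (Set.Icc 0 L) ∧ γ 0 = x ∧ γ L = y ∧
    (∀ t ∈ Set.Icc 0 L, γ t ∈ closedBall (midpoint ℝ x y) (dist x y / 2)) ∧
    d = ∫ t in (0 : ℝ)..L, (ω (γ t)) ^ ((1 : ℝ) / n)}

/-- One-dimensional Hausdorff content: infimum of `Σᵢ diam Bᵢ` over countable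
covers of `E` by balls `Bᵢ`. -/
noncomputable def H1content {n : ℕ} (E : Set (EuclideanSpace ℝ (Fin n))) : ℝ≥0∞ :=
  ⨅ (c : ℕ → EuclideanSpace ℝ (Fin n) × ℝ) (_ : E ⊆ ⋃ i, ball (c i).1 (c i).2),
    ∑' i, ENNReal.ofReal (2 * (c i).2)


section helpers
variable {E : Type*} [NormedAddCommGroup E]

/-- kernel -/
noncomputable def PhiK (R : ℝ) (z : E) : ℝ≥0∞ := 1 + ENNReal.ofReal (2 * R) / ‖z‖ₑ

lemma PhiK_measurable [MeasurableSpace E] [BorelSpace E] (R : ℝ) : Measurable (PhiK R : E → ℝ≥0∞) := by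
  unfold PhiK
  fun_prop

lemma PhiK_le_three {R : ℝ} (hR : 0 < R) {z : E} (hz : R ≤ ‖z‖) : PhiK R z ≤ 3 := by
  unfold PhiK
  have h0 : ENNReal.ofReal R ≤ ‖z‖ₑ := by
    rw [← ofReal_norm]; exact ENNReal.ofReal_le_ofReal hz
  have h1 : ENNReal.ofReal (2 * R) / ‖z‖ₑ ≤ 2 := by
    apply ENNReal.div_le_of_le_mul
    rw [ENNReal.ofReal_mul (by norm_num)]
    gcongr
    simp
  calc 1 + ENNReal.ofReal (2 * R) / ‖z‖ₑ ≤ 1 + 2 := by gcongr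
    _ = 3 := by norm_num

lemma PhiK_ofReal {R : ℝ} (hR : 0 < R) {z : E} (hz : z ≠ 0) :
    PhiK R z = ENNReal.ofReal (1 + 2 * R / ‖z‖) := by
  unfold PhiK
  have : 0 < ‖z‖ := norm_pos_iff.2 hz
  rw [ENNReal.ofReal_add (by norm_num) (by positivity), ENNReal.ofReal_div_of_pos this, ofReal_norm]
  simp

lemma PhiK_one_le (R : ℝ) (z : E) : 1 ≤ PhiK R z := by
  unfold PhiK; simp

variable [NormedSpace ℝ E] [FiniteDimensional ℝ E] [MeasurableSpace E] [BorelSpace E]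
  (μ : Measure E) [μ.IsAddHaarMeasure]

lemma PhiK_int_unit {s : ℝ} (hs : 0 ≤ s) (hsd : s < Module.finrank ℝ E) :
    ∫⁻ z in closedBall (0:E) 1, PhiK 1 z ^ s ∂μ ≠ ∞ := by
  have hd : 1 ≤ Module.finrank ℝ E := by
    by_contra h
    have : Module.finrank ℝ E = 0 := by omega
    rw [this] at hsd; simp at hsd; linarith
  have : Nontrivial E := Module.nontrivial_of_finrank_pos (R := ℝ) hd
  have hloc : LocallyIntegrable (fun x : E => ‖x‖ ^ (-s)) μ := by
    apply locallyIntegrable_of_norm_le_rpow hd hsd (C := 1)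
    · filter_upwards with x
      rw [Real.norm_of_nonneg (by positivity)]; simp
    · have : Measurable (fun x : E => ‖x‖ ^ (-s)) := by fun_prop
      exact this.aestronglyMeasurable
  have hint := hloc.integrableOn_isCompact (isCompact_closedBall (0:E) 1)
  have hfin : ∫⁻ z in closedBall (0:E) 1, ENNReal.ofReal (‖z‖ ^ (-s)) ∂μ < ∞ := by
    have := hint.2
    rw [hasFiniteIntegral_iff_ofReal] at this
    · exact this
    · filter_upwards with x
      simp; positivity
  have key : ∫⁻ z in closedBall (0:E) 1, PhiK 1 z ^ s ∂μ ≤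
      ENNReal.ofReal (3 ^ s) * ∫⁻ z in closedBall (0:E) 1, ENNReal.ofReal (‖z‖ ^ (-s)) ∂μ := by
    rw [← lintegral_const_mul _ (by fun_prop)]
    apply lintegral_mono_ae
    have hne : ∀ᵐ z ∂(μ.restrict (closedBall (0:E) 1)), z ≠ 0 :=
      ae_restrict_of_ae (Measure.ae_ne μ 0)
    filter_upwards [hne, ae_restrict_mem measurableSet_closedBall] with z hz hz1
    have hzp : 0 < ‖z‖ := norm_pos_iff.2 hz
    have hz1 : ‖z‖ ≤ 1 := by simpa using hz1
    rw [PhiK_ofReal one_pos hz, ENNReal.ofReal_rpow_of_pos (by positivity),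
      ← ENNReal.ofReal_mul (by positivity)]
    apply ENNReal.ofReal_le_ofReal
    rw [Real.rpow_neg hzp.le, ← Real.inv_rpow hzp.le, ← Real.mul_rpow (by norm_num) (by positivity)]
    apply Real.rpow_le_rpow (by positivity) _ hs
    have : 1 ≤ ‖z‖⁻¹ := (one_le_inv₀ hzp).2 hz1
    rw [div_eq_mul_inv]; linarith
  exact (lt_of_le_of_lt key (ENNReal.mul_lt_top ENNReal.ofReal_lt_top hfin)).ne

lemma PhiK_scale {R : ℝ} (hR : 0 < R) (y : E) (s : ℝ) :
    ∫⁻ x in closedBall y R, PhiK R (x - y) ^ s ∂μ =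
      ENNReal.ofReal R ^ (Module.finrank ℝ E) * ∫⁻ z in closedBall (0:E) 1, PhiK 1 z ^ s ∂μ := by
  set F : E → ℝ≥0∞ := (closedBall (0:E) R).indicator (fun z => PhiK R z ^ s) with hF
  have hFm : Measurable F := ((PhiK_measurable R).pow_const s).indicator measurableSet_closedBall
  have h1 : ∫⁻ x in closedBall y R, PhiK R (x - y) ^ s ∂μ = ∫⁻ x, F x ∂μ := by
    rw [← lintegral_indicator measurableSet_closedBall, ← lintegral_sub_right_eq_self F y]
    apply lintegral_congr
    intro x
    simp only [hF, indicator, mem_closedBall, dist_eq_norm, sub_zero]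
  have h2 : ∫⁻ x, F (R • x) ∂μ = ∫⁻ z in closedBall (0:E) 1, PhiK 1 z ^ s ∂μ := by
    rw [← lintegral_indicator measurableSet_closedBall]
    apply lintegral_congr
    intro x
    have e : PhiK R (R • x) = PhiK 1 x := by
      unfold PhiK
      congr 1
      rw [enorm_smul, Real.enorm_of_nonneg hR.le, mul_one, mul_comm 2 R, ENNReal.ofReal_mul hR.le]
      rw [ENNReal.mul_div_mul_left _ _ (by simpa using hR) ENNReal.ofReal_ne_top]
    simp only [hF, indicator, mem_closedBall, dist_eq_norm, sub_zero, e, norm_smul,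
      Real.norm_of_nonneg hR.le]
    congr 1
    apply propext
    constructor
    · intro h; nlinarith
    · intro h; nlinarith
  have h3 : ∫⁻ x, F (R • x) ∂μ = ENNReal.ofReal (R ^ (Module.finrank ℝ E))⁻¹ * ∫⁻ x, F x ∂μ := by
    rw [← lintegral_map hFm (measurable_const_smul R), Measure.map_addHaar_smul μ hR.ne',
      lintegral_smul_measure, abs_of_nonneg (by positivity), smul_eq_mul]
  rw [h1, ← h2, h3, ← mul_assoc, ← ENNReal.ofReal_pow hR.le, ← ENNReal.ofReal_mul (by positivity),
    mul_inv_cancel₀ (by positivity)]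
  simp

lemma PhiK_V {s : ℝ} (hs : 0 ≤ s) (hsd : s < Module.finrank ℝ E) :
    ∃ C : ℝ≥0∞, C ≠ ∞ ∧ ∀ R : ℝ, 0 < R → ∀ x0 y : E,
      ∫⁻ x in closedBall x0 R, PhiK R (x - y) ^ s ∂μ ≤ C * μ (closedBall x0 R) := by
  have hm : μ (closedBall (0:E) 1) ≠ 0 := (measure_closedBall_pos μ 0 one_pos).ne'
  have hm' : μ (closedBall (0:E) 1) ≠ ∞ := (isCompact_closedBall (0:E) 1).measure_lt_top.ne
  refine ⟨(∫⁻ z in closedBall (0:E) 1, PhiK 1 z ^ s ∂μ) / μ (closedBall (0:E) 1) + 3 ^ s, ?_, ?_⟩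
  · apply ENNReal.add_ne_top.2 ⟨ENNReal.div_ne_top (PhiK_int_unit μ hs hsd) hm, ?_⟩
    exact ENNReal.rpow_ne_top_of_nonneg hs (by norm_num)
  · intro R hR x0 y
    have hsub : closedBall x0 R ⊆ closedBall y R ∪ (closedBall x0 R \ closedBall y R) := by
      intro x hx; by_cases h : x ∈ closedBall y R <;> simp_all
    calc ∫⁻ x in closedBall x0 R, PhiK R (x - y) ^ s ∂μ
        ≤ ∫⁻ x in closedBall y R ∪ (closedBall x0 R \ closedBall y R), PhiK R (x - y) ^ s ∂μ :=
          lintegral_mono_set hsub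
      _ ≤ ∫⁻ x in closedBall y R, PhiK R (x - y) ^ s ∂μ +
          ∫⁻ x in closedBall x0 R \ closedBall y R, PhiK R (x - y) ^ s ∂μ := lintegral_union_le _ _ _
      _ ≤ (∫⁻ z in closedBall (0:E) 1, PhiK 1 z ^ s ∂μ) / μ (closedBall (0:E) 1) * μ (closedBall x0 R)
          + 3 ^ s * μ (closedBall x0 R) := by
          apply add_le_add
          · rw [PhiK_scale μ hR, Measure.addHaar_closedBall' μ x0 hR.le,
              mul_comm (ENNReal.ofReal (R ^ _)), ← mul_assoc, ENNReal.div_mul_cancel hm hm',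
              mul_comm, ENNReal.ofReal_pow hR.le]
          · calc ∫⁻ x in closedBall x0 R \ closedBall y R, PhiK R (x - y) ^ s ∂μ
                ≤ ∫⁻ x in closedBall x0 R \ closedBall y R, 3 ^ s ∂μ := by
                  apply setLIntegral_mono measurable_const
                  intro x hx
                  apply ENNReal.rpow_le_rpow _ hs
                  apply PhiK_le_three hR
                  have := hx.2
                  simp only [mem_closedBall, dist_eq_norm, not_le] at this
                  exact this.le
              _ ≤ 3 ^ s * μ (closedBall x0 R) := by
                  rw [setLIntegral_const]
                  gcongr
                  exact sdiff_subset
      _ = _ := by rw [add_mul]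

end helpers

lemma jensenJ {X : Type*} [MeasurableSpace X] (μ : Measure X) {g h : X → ℝ} {q : ℝ} (hq : 0 < q)
    (hh : Integrable h μ) (h0 : ∀ x, 0 ≤ h x) (hgh : Integrable (fun x => g x * h x) μ)
    (hle : ∫ x, h x ∂μ ≤ q) (hg : Measurable g) :
    ENNReal.ofReal (Real.exp (∫ x, g x * h x ∂μ)) ≤
      1 + ∫⁻ x, ENNReal.ofReal (Real.exp (q * g x)) * ENNReal.ofReal (h x / q) ∂μ := by
  set m := ∫ x, g x * h x ∂μ with hm
  set a := ∫ x, h x ∂μ with ha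
  by_cases hfin : ∫⁻ x, ENNReal.ofReal (Real.exp (q * g x)) * ENNReal.ofReal (h x / q) ∂μ = ∞
  · rw [hfin]; simp
  have heq : ∀ x, ENNReal.ofReal (Real.exp (q * g x)) * ENNReal.ofReal (h x / q) =
      ENNReal.ofReal (Real.exp (q * g x) * (h x / q)) := fun x =>
    (ENNReal.ofReal_mul (Real.exp_pos _).le).symm
  simp only [heq] at hfin ⊢
  have hnn : 0 ≤ᵐ[μ] fun x => Real.exp (q * g x) * (h x / q) :=
    Filter.Eventually.of_forall fun x => mul_nonneg (Real.exp_pos _).le (div_nonneg (h0 x) hq.le)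
  have hint : Integrable (fun x => Real.exp (q * g x) * (h x / q)) μ := by
    refine ⟨?_, ?_⟩
    · refine AEStronglyMeasurable.mul ?_ (hh.div_const q).1
      exact (Real.measurable_exp.comp (hg.const_mul q)).aestronglyMeasurable
    · rw [hasFiniteIntegral_iff_ofReal hnn]; exact lt_top_iff_ne_top.2 hfin
  rw [← ofReal_integral_eq_lintegral_ofReal hint hnn, ← ENNReal.ofReal_one,
    ← ENNReal.ofReal_add zero_le_one (integral_nonneg_of_ae hnn)]
  apply ENNReal.ofReal_le_ofReal
  have h1 : ∫ x, Real.exp m * ((1 - m) / q * h x + g x * h x) ∂μ ≤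
      ∫ x, Real.exp (q * g x) * (h x / q) ∂μ := by
    apply integral_mono_ae
    · exact (((hh.const_mul _).add hgh).const_mul _)
    · exact hint
    · filter_upwards with x
      have e1 : Real.exp m * (q * g x - m + 1) ≤ Real.exp (q * g x) := by
        have := Real.add_one_le_exp (q * g x - m)
        calc Real.exp m * (q * g x - m + 1) ≤ Real.exp m * Real.exp (q * g x - m) := by gcongr
          _ = _ := by rw [← Real.exp_add]; ring_nf
      calc Real.exp m * ((1 - m) / q * h x + g x * h x)
          = (Real.exp m * (q * g x - m + 1)) * (h x / q) := by field_simp; ring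
        _ ≤ _ := mul_le_mul_of_nonneg_right e1 (div_nonneg (h0 x) hq.le)
  rw [integral_const_mul, integral_add (hh.const_mul _) hgh, integral_const_mul, ← hm, ← ha] at h1
  have h2 : Real.exp m * (1 - m) ≤ 1 := by
    have := Real.add_one_le_exp (-m)
    calc Real.exp m * (1 - m) ≤ Real.exp m * Real.exp (-m) := by gcongr; linarith
      _ = 1 := by rw [← Real.exp_add]; simp
  have ha0 : 0 ≤ a := integral_nonneg h0
  have hr : 0 ≤ 1 - a / q := by
    rw [sub_nonneg, div_le_one hq]; exact hle
  have h3 := mul_le_mul_of_nonneg_left h2 hr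
  have h4 : 0 ≤ a / q := div_nonneg ha0 hq.le
  have e : (1 - a / q) * (Real.exp m * (1 - m)) + Real.exp m * ((1 - m) / q * a + m) = Real.exp m := by
    field_simp; ring
  linarith

lemma markovM {X : Type*} [MeasurableSpace X] (μ : Measure X) {G : X → ℝ≥0∞} (hG : Measurable G)
    {B : Set X} (hB : MeasurableSet B) {K : ℝ} (hK : 0 < K) (hfin : μ B ≠ ∞)
    (hle : ∫⁻ x in B, G x ∂μ ≤ ENNReal.ofReal K * μ B) :
    μ B / 2 ≤ μ (B ∩ {x | G x ≤ ENNReal.ofReal (2 * K)}) := by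
  have h1 : ENNReal.ofReal (2 * K) * μ (B ∩ {x | ENNReal.ofReal (2 * K) ≤ G x}) ≤
      ENNReal.ofReal (2 * K) * (μ B / 2) := by
    have := mul_meas_ge_le_lintegral (μ := μ.restrict B) hG (ENNReal.ofReal (2 * K))
    rw [Measure.restrict_apply' hB, inter_comm] at this
    refine this.trans (hle.trans (le_of_eq ?_))
    rw [ENNReal.ofReal_mul (by norm_num), mul_comm (ENNReal.ofReal 2), mul_assoc]
    congr 1
    rw [ENNReal.ofReal_ofNat, ENNReal.mul_div_cancel (by norm_num) (by norm_num)]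
  have h2 : μ (B ∩ {x | ENNReal.ofReal (2 * K) ≤ G x}) ≤ μ B / 2 := by
    rwa [ENNReal.mul_le_mul_iff_right (by simpa using hK) ENNReal.ofReal_ne_top] at h1
  have h3 : μ B ≤ μ (B ∩ {x | G x ≤ ENNReal.ofReal (2 * K)}) + μ (B ∩ {x | ENNReal.ofReal (2 * K) ≤ G x}) := by
    refine (measure_mono ?_).trans (measure_union_le _ _)
    intro x hx
    rcases le_total (G x) (ENNReal.ofReal (2 * K)) with h | h
    · left; exact ⟨hx, h⟩
    · right; exact ⟨hx, h⟩
  have h4 : μ B / 2 + μ B / 2 ≤ μ (B ∩ {x | G x ≤ ENNReal.ofReal (2 * K)}) + μ B / 2 := by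
    rw [ENNReal.add_halves]; exact h3.trans (by gcongr)
  exact (ENNReal.add_le_add_iff_right (ENNReal.div_ne_top hfin (by norm_num))).1 h4

section Gsec
variable {E : Type*} [NormedAddCommGroup E] [NormedSpace ℝ E] [FiniteDimensional ℝ E]
  [MeasurableSpace E] [BorelSpace E]
variable {Y : Type*} [MeasurableSpace Y]

/-- averaged kernel -/
noncomputable def GK (ν : Measure Y) (R s : ℝ) (h : Y → ℝ) (T : Y → E) (x : E) : ℝ≥0∞ :=
  1 + ∫⁻ y, PhiK R (x - T y) ^ s * ENNReal.ofReal (h y) ∂ν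

lemma GK_measurable2 (R s : ℝ) {h : Y → ℝ} (hh : Measurable h)
    {T : Y → E} (hT : Measurable T) :
    Measurable (fun z : E × Y => PhiK R (z.1 - T z.2) ^ s * ENNReal.ofReal (h z.2)) := by
  have := (PhiK_measurable (E := E) R)
  have h2 : Measurable (fun z : E × Y => z.1 - T z.2) := by fun_prop
  exact ((this.comp h2).pow_const s).mul (by fun_prop)

lemma GK_measurable (ν : Measure Y) [SFinite ν] (R s : ℝ) {h : Y → ℝ} (hh : Measurable h)
    {T : Y → E} (hT : Measurable T) : Measurable (GK ν R s h T) := by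
  unfold GK
  exact ((GK_measurable2 R s hh hT).lintegral_prod_right').const_add 1

lemma GK_int (ν : Measure Y) [SFinite ν] (μ : Measure E) [μ.IsAddHaarMeasure] {s : ℝ} (hs : 0 ≤ s)
    (hsd : s < Module.finrank ℝ E) :
    ∃ K : ℝ, 0 < K ∧ ∀ (h : Y → ℝ) (T : Y → E), Measurable h → Measurable T →
      ∫⁻ y, ENNReal.ofReal (h y) ∂ν ≤ 1 → ∀ (R : ℝ), 0 < R → ∀ x0 : E,
      ∫⁻ x in closedBall x0 R, GK ν R s h T x ∂μ ≤ ENNReal.ofReal K * μ (closedBall x0 R) := by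
  obtain ⟨C, hC, hV⟩ := PhiK_V μ hs hsd
  refine ⟨1 + C.toReal, by positivity, ?_⟩
  intro h T hh hT h1 R hR x0
  rw [ENNReal.ofReal_add zero_le_one ENNReal.toReal_nonneg, ENNReal.ofReal_toReal hC]
  unfold GK
  rw [lintegral_add_left measurable_const, add_mul]
  apply add_le_add
  · simp
  · rw [lintegral_lintegral_swap (GK_measurable2 R s hh hT).aemeasurable]
    calc ∫⁻ y, ∫⁻ x in closedBall x0 R, PhiK R (x - T y) ^ s * ENNReal.ofReal (h y) ∂μ ∂ν
        ≤ ∫⁻ y, (C * μ (closedBall x0 R)) * ENNReal.ofReal (h y) ∂ν := by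
          apply lintegral_mono
          intro y
          dsimp only
          rw [lintegral_mul_const']
          · gcongr
            exact hV R hR x0 (T y)
          · exact ENNReal.ofReal_ne_top
      _ ≤ _ := by
          rw [lintegral_const_mul _ (by fun_prop)]
          calc _ ≤ (C * μ (closedBall x0 R)) * 1 := by gcongr
            _ = _ := mul_one _

lemma GK_bdd (μ : Measure E) [μ.IsAddHaarMeasure] {s : ℝ} (hs : 0 ≤ s)
    (hsd : s < Module.finrank ℝ E) {h : E → ℝ} (hc : Continuous h)
    (hi : ∫⁻ y, ENNReal.ofReal (h y) ∂μ ≠ ∞) {R : ℝ} (hR : 0 < R) (x0 : E) :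
    ∃ M : ℝ, 0 < M ∧ ∀ x ∈ closedBall x0 R, GK μ R s h id x ≤ ENNReal.ofReal M := by
  obtain ⟨C, hC, hV⟩ := PhiK_V μ hs hsd
  obtain ⟨B, hB⟩ := (isCompact_closedBall x0 (2 * R)).exists_bound_of_continuousOn hc.continuousOn
  set v := μ (closedBall (0:E) R) with hv
  have hvt : v ≠ ∞ := (isCompact_closedBall (0:E) R).measure_lt_top.ne
  set Mt : ℝ≥0∞ := 1 + (C * v * ENNReal.ofReal B + 3 ^ s * ∫⁻ y, ENNReal.ofReal (h y) ∂μ) with hMt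
  have h3 : (3:ℝ≥0∞) ^ s ≠ ∞ := ENNReal.rpow_ne_top_of_nonneg hs (by norm_num)
  have hMtt : Mt ≠ ∞ := by
    refine ENNReal.add_ne_top.2 ⟨by simp, ENNReal.add_ne_top.2 ⟨?_, ENNReal.mul_ne_top h3 hi⟩⟩
    exact ENNReal.mul_ne_top (ENNReal.mul_ne_top hC hvt) ENNReal.ofReal_ne_top
  refine ⟨Mt.toReal, ENNReal.toReal_pos (by simp [hMt]) hMtt, ?_⟩
  intro x hx
  rw [ENNReal.ofReal_toReal hMtt]
  unfold GK
  rw [hMt]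
  gcongr
  simp only [id]
  rw [← lintegral_add_compl _ (measurableSet_closedBall : MeasurableSet (closedBall x R))]
  apply add_le_add
  · have hvx : μ (closedBall x R) = v := by rw [hv, Measure.addHaar_closedBall_center]
    calc ∫⁻ y in closedBall x R, PhiK R (x - y) ^ s * ENNReal.ofReal (h y) ∂μ
        ≤ ∫⁻ y in closedBall x R, PhiK R (y - x) ^ s * ENNReal.ofReal B ∂μ := by
          apply setLIntegral_mono' measurableSet_closedBall
          intro y hy
          have e : PhiK R (x - y) = PhiK R (y - x) := by
            unfold PhiK; rw [← enorm_neg, neg_sub]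
          rw [e]
          gcongr
          refine (le_abs_self _).trans (hB y ?_)
          rw [mem_closedBall] at *
          linarith [dist_triangle y x x0]
      _ ≤ _ := by
          rw [lintegral_mul_const' _ _ ENNReal.ofReal_ne_top]
          gcongr
          rw [← hvx]
          exact hV R hR x x
  · calc ∫⁻ y in (closedBall x R)ᶜ, PhiK R (x - y) ^ s * ENNReal.ofReal (h y) ∂μ
        ≤ ∫⁻ y in (closedBall x R)ᶜ, 3 ^ s * ENNReal.ofReal (h y) ∂μ := by
          apply setLIntegral_mono' measurableSet_closedBall.compl
          intro y hy
          gcongr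
          apply PhiK_le_three hR
          simp only [mem_compl_iff, mem_closedBall, dist_eq_norm, not_le] at hy
          rw [norm_sub_rev]; exact hy.le
      _ ≤ _ := by
          rw [lintegral_const_mul' _ _ h3]
          gcongr
          exact Measure.restrict_le_self

end Gsec

lemma cN_pos (n : ℕ) (hn : 2 ≤ n) : 0 < cN n := by
  unfold cN
  have : 0 < Real.Gamma ((n:ℝ) / 2) := Real.Gamma_pos_of_pos (by positivity)
  positivity

/-- hypotheses on f -/
structure GoodF (n : ℕ) (f : EuclideanSpace ℝ (Fin n) → ℝ) : Prop where
  cont : Continuous f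
  int : Integrable f
  log : ∀ x : EuclideanSpace ℝ (Fin n), Integrable (fun y => Real.log (‖y‖ / ‖x - y‖) * f y)

lemma GoodF.neg {n : ℕ} {f : EuclideanSpace ℝ (Fin n) → ℝ} (h : GoodF n f) :
    GoodF n (fun x => - f x) := by
  refine ⟨h.cont.neg, h.int.neg, fun x => ?_⟩
  have := (h.log x).neg
  refine this.congr (Filter.Eventually.of_forall fun y => ?_)
  simp

/-- normalizing constant -/
noncomputable def AP (n : ℕ) (f : EuclideanSpace ℝ (Fin n) → ℝ)
    (x0 : EuclideanSpace ℝ (Fin n)) (R : ℝ) : ℝ :=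
  (1 / cN n) * ∫ y, Real.log (‖y‖ / (R + ‖x0 - y‖)) * f y

lemma AP_neg (n : ℕ) (f : EuclideanSpace ℝ (Fin n) → ℝ) (x0 : EuclideanSpace ℝ (Fin n)) (R : ℝ) :
    AP n (fun x => - f x) x0 R = - AP n f x0 R := by
  unfold AP; simp [integral_neg]

lemma logPot_neg (n : ℕ) (f : EuclideanSpace ℝ (Fin n) → ℝ) (x : EuclideanSpace ℝ (Fin n)) :
    logPot n (fun x => - f x) x = - logPot n f x := by
  unfold logPot; simp [integral_neg]

lemma logPot_measurable {n : ℕ} {f : EuclideanSpace ℝ (Fin n) → ℝ} (h : GoodF n f) :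
    Measurable (logPot n f) := by
  unfold logPot
  apply Measurable.const_mul
  apply StronglyMeasurable.measurable
  have := h.cont.measurable
  have hm : Measurable (fun z : EuclideanSpace ℝ (Fin n) × EuclideanSpace ℝ (Fin n) =>
      Real.log (‖z.2‖ / ‖z.1 - z.2‖) * f z.2) := by fun_prop
  exact hm.stronglyMeasurable.integral_prod_right'

lemma k_bound {E : Type*} [NormedAddCommGroup E] {x0 x y : E} {R : ℝ} (hR : 0 < R)
    (hx : x ∈ closedBall x0 R) :
    0 ≤ Real.log ((R + ‖x0 - y‖) / ‖x - y‖) ∧ ∀ t : ℝ, 0 ≤ t →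
      ENNReal.ofReal (Real.exp (t * Real.log ((R + ‖x0 - y‖) / ‖x - y‖))) ≤ PhiK R (x - y) ^ t := by
  by_cases hxy : x = y
  · subst hxy
    simp only [sub_self, norm_zero, div_zero, Real.log_zero, le_refl, mul_zero, Real.exp_zero,
      ENNReal.ofReal_one, true_and]
    intro t ht
    simpa using ENNReal.rpow_le_rpow (PhiK_one_le R (0 : E)) ht
  · have hne : x - y ≠ 0 := sub_ne_zero.2 hxy
    have hp : 0 < ‖x - y‖ := norm_pos_iff.2 hne
    rw [mem_closedBall, dist_eq_norm] at hx
    have h1 : ‖x - y‖ ≤ R + ‖x0 - y‖ := by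
      have : x - y = (x - x0) + (x0 - y) := by abel
      rw [this]
      exact (norm_add_le _ _).trans (by linarith)
    have h2 : R + ‖x0 - y‖ ≤ 2 * R + ‖x - y‖ := by
      have : x0 - y = -(x - x0) + (x - y) := by abel
      have h := norm_add_le (-(x - x0)) (x - y)
      rw [← this, norm_neg] at h
      linarith
    have hr : 1 ≤ (R + ‖x0 - y‖) / ‖x - y‖ := (one_le_div hp).2 h1
    refine ⟨Real.log_nonneg hr, fun t ht => ?_⟩
    rw [PhiK_ofReal hR hne, ENNReal.ofReal_rpow_of_pos (by positivity)]
    apply ENNReal.ofReal_le_ofReal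
    rw [mul_comm, ← Real.rpow_def_of_pos (by positivity)]
    apply Real.rpow_le_rpow (by positivity) _ ht
    rw [div_le_iff₀ hp, add_mul, div_mul_cancel₀ _ hp.ne']
    linarith

lemma k_int {n : ℕ} (hn : 2 ≤ n) {f : EuclideanSpace ℝ (Fin n) → ℝ} (h : GoodF n f)
    {x0 x : EuclideanSpace ℝ (Fin n)} {R : ℝ} (hR : 0 < R) (hx : x ∈ closedBall x0 R) :
    Integrable (fun y => Real.log ((R + ‖x0 - y‖) / ‖x - y‖) * f y) := by
  have hfm := h.cont.measurable
  have hi : ∫⁻ y, ENNReal.ofReal (|f y|) ≠ ∞ := by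
    have := h.int.2
    rw [hasFiniteIntegral_iff_norm] at this
    exact this.ne
  obtain ⟨M, hM, hb⟩ := GK_bdd (volume : Measure (EuclideanSpace ℝ (Fin n))) (s := 1) zero_le_one
    (by simp; omega) h.cont.abs hi hR x0
  refine ⟨?_, ?_⟩
  · have : Measurable (fun y => Real.log ((R + ‖x0 - y‖) / ‖x - y‖) * f y) := by fun_prop
    exact this.aestronglyMeasurable
  · rw [hasFiniteIntegral_iff_norm]
    have h1 := hb x hx
    unfold GK at h1
    refine lt_of_le_of_lt ?_ (lt_of_le_of_lt (le_add_left le_rfl |>.trans h1) ENNReal.ofReal_lt_top)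
    apply lintegral_mono
    intro y
    dsimp only [id]
    obtain ⟨k0, kb⟩ := k_bound (y := y) hR hx
    rw [norm_mul, ENNReal.ofReal_mul (norm_nonneg _)]
    have e : ENNReal.ofReal ‖f y‖ = ENNReal.ofReal |f y| := rfl
    rw [e]
    gcongr
    refine le_trans ?_ (kb 1 zero_le_one)
    apply ENNReal.ofReal_le_ofReal
    rw [Real.norm_of_nonneg k0, one_mul]
    linarith [Real.add_one_le_exp (Real.log ((R + ‖x0 - y‖) / ‖x - y‖))]

lemma logPot_sub {n : ℕ} (hn : 2 ≤ n) {f : EuclideanSpace ℝ (Fin n) → ℝ} (h : GoodF n f)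
    {x0 x : EuclideanSpace ℝ (Fin n)} {R : ℝ} (hR : 0 < R) (hx : x ∈ closedBall x0 R) :
    logPot n f x - AP n f x0 R =
      (1 / cN n) * ∫ y, Real.log ((R + ‖x0 - y‖) / ‖x - y‖) * f y := by
  have : NeZero n := ⟨by omega⟩
  have key : ∀ z, (fun y => Real.log (‖y‖ / ‖z - y‖) * f y - Real.log ((R + ‖x0 - y‖) / ‖z - y‖) * f y)
      =ᵐ[volume] fun y => Real.log (‖y‖ / (R + ‖x0 - y‖)) * f y := by
    intro z
    filter_upwards [Measure.ae_ne volume 0, Measure.ae_ne volume z] with y hy0 hyz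
    have h1 : ‖y‖ ≠ 0 := norm_ne_zero_iff.2 hy0
    have h2 : ‖z - y‖ ≠ 0 := norm_ne_zero_iff.2 (sub_ne_zero.2 (Ne.symm hyz))
    have h3 : R + ‖x0 - y‖ ≠ 0 := by positivity
    rw [Real.log_div h1 h2, Real.log_div h3 h2, Real.log_div h1 h3]
    ring
  unfold logPot AP
  rw [← integral_congr_ae (key x), integral_sub (h.log x) (k_int hn h hR hx)]
  ring

lemma pot_le {n : ℕ} (hn : 2 ≤ n) {f : EuclideanSpace ℝ (Fin n) → ℝ} (h : GoodF n f)
    {x0 x : EuclideanSpace ℝ (Fin n)} {R : ℝ} (hR : 0 < R) (hx : x ∈ closedBall x0 R)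
    {σ q : ℝ} (hσ : 0 ≤ σ) (hq : 0 < q) (hm : ∫ y, max (f y) 0 ≤ q * cN n) :
    ENNReal.ofReal (Real.exp (σ * (logPot n f x - AP n f x0 R))) ≤
      GK volume R (σ * q) (fun y => max (f y) 0 / (q * cN n)) id x := by
  have hc := cN_pos n hn
  set k : EuclideanSpace ℝ (Fin n) → ℝ := fun y => Real.log ((R + ‖x0 - y‖) / ‖x - y‖) with hk
  have hk0 : ∀ y, 0 ≤ k y := fun y => (k_bound (y := y) hR hx).1
  have hki : Integrable (fun y => k y * f y) := k_int hn h hR hx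
  have hki' : Integrable (fun y => k y * max (f y) 0) := by
    refine hki.pos_part.congr (Filter.Eventually.of_forall fun y => ?_)
    dsimp only
    rw [mul_max_of_nonneg _ _ (hk0 y), mul_zero]
  have e1 : σ * (logPot n f x - AP n f x0 R) ≤ ∫ y, (σ * k y) * (max (f y) 0 / cN n) := by
    rw [logPot_sub hn h hR hx]
    have e2 : (fun y => (σ * k y) * (max (f y) 0 / cN n)) =
        fun y => σ * ((1 / cN n) * (k y * max (f y) 0)) := by
      funext y; field_simp
    rw [e2, integral_const_mul, integral_const_mul]
    gcongr
    intro y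
    exact mul_le_mul_of_nonneg_left (le_max_left _ _) (hk0 y)
  have J := jensenJ volume (g := fun y => σ * k y) (h := fun y => max (f y) 0 / cN n) hq
    (h.int.pos_part.div_const _) (fun y => by positivity) (by
      refine (hki'.const_mul (σ / cN n)).congr (Filter.Eventually.of_forall fun y => ?_)
      dsimp only; field_simp) (by rw [integral_div]; rwa [div_le_iff₀ hc]) (by fun_prop)
  refine (ENNReal.ofReal_le_ofReal (Real.exp_le_exp.2 e1)).trans (J.trans ?_)
  unfold GK
  gcongr with y
  · have := (k_bound (y := y) hR hx).2 (σ * q) (by positivity)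
    refine le_trans (le_of_eq ?_) this
    congr 2; ring
  · apply le_of_eq; field_simp

lemma mass_le {n : ℕ} (hn : 2 ≤ n) {f : EuclideanSpace ℝ (Fin n) → ℝ} (h : GoodF n f)
    {q : ℝ} (hq : 0 < q) (hm : ∫ y, max (f y) 0 ≤ q * cN n) :
    ∫⁻ y, ENNReal.ofReal (max (f y) 0 / (q * cN n)) ≤ 1 := by
  have hc := cN_pos n hn
  rw [← ofReal_integral_eq_lintegral_ofReal (h.int.pos_part.div_const _)
    (Filter.Eventually.of_forall fun y => by simp only [Pi.zero_apply]; positivity), integral_div,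
    ← ENNReal.ofReal_one]
  apply ENNReal.ofReal_le_ofReal
  rw [div_le_one (by positivity)]; exact hm

lemma up_int {n : ℕ} (hn : 2 ≤ n) {σ q : ℝ} (hσ : 0 ≤ σ) (hq : 0 < q) (hs : σ * q < n) :
    ∃ K : ℝ, 0 < K ∧ ∀ f : EuclideanSpace ℝ (Fin n) → ℝ, GoodF n f →
      ∫ y, max (f y) 0 ≤ q * cN n → ∀ (x0 : EuclideanSpace ℝ (Fin n)) (R : ℝ), 0 < R →
      ∫⁻ x in closedBall x0 R, ENNReal.ofReal (Real.exp (σ * (logPot n f x - AP n f x0 R))) ≤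
        ENNReal.ofReal K * volume (closedBall x0 R) := by
  obtain ⟨K, hK, hb⟩ := GK_int (volume : Measure (EuclideanSpace ℝ (Fin n)))
    (volume : Measure (EuclideanSpace ℝ (Fin n))) (s := σ * q) (by positivity) (by simpa using hs)
  refine ⟨K, hK, fun f hf hm x0 R hR => ?_⟩
  have hfm := hf.cont.measurable
  refine le_trans ?_ (hb (fun y => max (f y) 0 / (q * cN n)) id (by fun_prop) measurable_id
    (mass_le hn hf hq hm) R hR x0)
  apply setLIntegral_mono' measurableSet_closedBall
  intro x hx
  exact pot_le hn hf hR hx hσ hq hm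

lemma up_line {n : ℕ} (hn : 2 ≤ n) {σ q : ℝ} (hσ : 0 ≤ σ) (hq : 0 < q) (hs : σ * q < 1) :
    ∃ K : ℝ, 0 < K ∧ ∀ f : EuclideanSpace ℝ (Fin n) → ℝ, GoodF n f →
      ∫ y, max (f y) 0 ≤ q * cN n → ∀ (x0 : EuclideanSpace ℝ (Fin n)) (R : ℝ), 0 < R →
      ∀ (w e : EuclideanSpace ℝ (Fin n)), ‖e‖ = 1 →
      ∃ G : ℝ → ℝ≥0∞, Measurable G ∧
        ∫⁻ t in Icc 0 (2 * R), G t ≤ ENNReal.ofReal K * volume (Icc 0 (2 * R)) ∧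
        ∀ z ∈ closedBall x0 R, ENNReal.ofReal (Real.exp (σ * (logPot n f z - AP n f x0 R))) ≤
          G (inner ℝ e (z - w)) := by
  obtain ⟨K, hK, hb⟩ := GK_int (volume : Measure (EuclideanSpace ℝ (Fin n)))
    (volume : Measure ℝ) (s := σ * q) (by positivity) (by simpa using hs)
  refine ⟨K, hK, fun f hf hm x0 R hR w e he => ?_⟩
  have hfm := hf.cont.measurable
  set T : EuclideanSpace ℝ (Fin n) → ℝ := fun y => inner ℝ e (y - w) with hT
  have hTm : Measurable T := by
    have : Continuous T := by rw [hT]; fun_prop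
    exact this.measurable
  have hhm : Measurable (fun y => max (f y) 0 / (q * cN n)) := by fun_prop
  refine ⟨GK volume R (σ * q) (fun y => max (f y) 0 / (q * cN n)) T, GK_measurable _ _ _ hhm hTm, ?_, ?_⟩
  · have := hb _ T hhm hTm (mass_le hn hf hq hm) R hR R
    rw [Real.closedBall_eq_Icc, sub_self, ← two_mul] at this
    exact this
  · intro z hz
    refine (pot_le hn hf hR hz hσ hq hm).trans ?_
    unfold GK
    gcongr with y
    dsimp only [id]
    unfold PhiK
    gcongr
    rw [hT]
    dsimp only
    rw [← inner_sub_right, ← ofReal_norm, ← ofReal_norm]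
    apply ENNReal.ofReal_le_ofReal
    refine (norm_inner_le_norm _ _).trans ?_
    rw [he, one_mul]
    apply le_of_eq; congr 1; abel

lemma pot_bdd {n : ℕ} (hn : 2 ≤ n) {f : EuclideanSpace ℝ (Fin n) → ℝ} (h : GoodF n f)
    {q : ℝ} (hq : 0 < q) (hq1 : q < 1) (hm : ∫ y, max (f y) 0 ≤ q * cN n)
    (x0 : EuclideanSpace ℝ (Fin n)) {R : ℝ} (hR : 0 < R) :
    ∃ M : ℝ, 0 < M ∧ ∀ x ∈ closedBall x0 R, Real.exp (logPot n f x) ≤ M := by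
  have hc := cN_pos n hn
  have hcont := h.cont
  have hn' : (2:ℝ) ≤ n := by exact_mod_cast hn
  obtain ⟨M, hM, hb⟩ := GK_bdd (volume : Measure (EuclideanSpace ℝ (Fin n))) (s := 1 * q)
    (by positivity) (by simp; linarith) (h := fun y => max (f y) 0 / (q * cN n)) (by fun_prop)
    (lt_of_le_of_lt (mass_le hn h hq hm) (by simp)).ne hR x0
  refine ⟨Real.exp (AP n f x0 R) * M, by positivity, fun x hx => ?_⟩
  have h1 := (pot_le hn h hR hx zero_le_one hq hm).trans (hb x hx)
  rw [ENNReal.ofReal_le_ofReal_iff hM.le, one_mul] at h1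
  calc Real.exp (logPot n f x) = Real.exp (AP n f x0 R) * Real.exp (logPot n f x - AP n f x0 R) := by
        rw [← Real.exp_add]; ring_nf
    _ ≤ _ := by gcongr

/-- conversion to a real integral bound -/
lemma real_int_le {X : Type*} [MeasurableSpace X] (μ : Measure X) {g : X → ℝ} (hg : Measurable g)
    {B : Set X} {σ A K : ℝ} (hK : 0 < K) (hB : μ B ≠ ∞)
    (hle : ∫⁻ x in B, ENNReal.ofReal (Real.exp (σ * (g x - A))) ∂μ ≤ ENNReal.ofReal K * μ B) :
    ∫ x in B, Real.exp (σ * g x) ∂μ ≤ Real.exp (σ * A) * (K * (μ B).toReal) := by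
  have e : ∀ x, Real.exp (σ * g x) = Real.exp (σ * A) * Real.exp (σ * (g x - A)) := by
    intro x; rw [← Real.exp_add]; ring_nf
  simp only [e]
  rw [integral_const_mul]
  gcongr
  rw [integral_eq_lintegral_of_nonneg_ae (Filter.Eventually.of_forall fun x => (Real.exp_pos _).le)
    (by fun_prop)]
  calc _ ≤ (ENNReal.ofReal K * μ B).toReal :=
        ENNReal.toReal_mono (ENNReal.mul_ne_top ENNReal.ofReal_ne_top hB) hle
    _ = _ := by rw [ENNReal.toReal_mul, ENNReal.toReal_ofReal hK.le]

/-- lower bound for an integral from a large set -/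
lemma real_int_ge {X : Type*} [MeasurableSpace X] (μ : Measure X) {F : X → ℝ}
    {B P : Set X} {a v : ℝ} (hF : IntegrableOn F B μ) (hF0 : ∀ x, 0 ≤ F x) (ha : 0 ≤ a) (hv : 0 ≤ v)
    (hP : ∀ x ∈ P, x ∈ B ∧ a ≤ F x) (hPv : ENNReal.ofReal v ≤ μ P) :
    a * v ≤ ∫ x in B, F x ∂μ := by
  have h1 := mul_meas_ge_le_lintegral₀ (μ := μ.restrict B) hF.1.aemeasurable.ennreal_ofReal
    (ENNReal.ofReal a)
  rw [← ofReal_integral_eq_lintegral_ofReal hF (Filter.Eventually.of_forall hF0)] at h1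
  have h2 : μ P ≤ μ.restrict B {x | ENNReal.ofReal a ≤ ENNReal.ofReal (F x)} := by
    refine le_trans (measure_mono ?_) (Measure.le_restrict_apply _ _)
    intro x hx
    exact ⟨ENNReal.ofReal_le_ofReal (hP x hx).2, (hP x hx).1⟩
  have h3 : ENNReal.ofReal (a * v) ≤ ENNReal.ofReal (∫ x in B, F x ∂μ) := by
    rw [ENNReal.ofReal_mul ha]
    exact le_trans (by gcongr; exact hPv.trans h2) h1
  exact (ENNReal.ofReal_le_ofReal_iff (integral_nonneg hF0)).1 h3

/-- pointwise lower bound -/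
lemma exp_lower {σ m u A K : ℝ} (hσ : 0 < σ) (hm : 0 ≤ m) (hK : 0 < K)
    (h : Real.exp (σ * (-u - -A)) ≤ 2 * K) :
    Real.exp (m * A) * (2 * K) ^ (-(m / σ)) ≤ Real.exp (m * u) := by
  have h2 : σ * (-u - -A) ≤ Real.log (2 * K) := (Real.le_log_iff_exp_le (by positivity)).2 h
  rw [Real.rpow_def_of_pos (by positivity), ← Real.exp_add]
  apply Real.exp_le_exp.2
  have h3 : m / σ * (σ * (-u - -A)) ≤ m / σ * Real.log (2 * K) := by gcongr
  have h4 : m / σ * (σ * (-u - -A)) = m * (A - u) := by field_simp; ring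
  rw [h4] at h3
  linarith

/-- all analytic bounds for the volume -/
lemma delta_bounds {n : ℕ} (hn : 2 ≤ n) {q q' : ℝ} (hq : 0 < q) (hq1 : q < 1) (hq' : 0 < q') :
    ∃ k K : ℝ, 0 < k ∧ 0 < K ∧ ∀ f : EuclideanSpace ℝ (Fin n) → ℝ, GoodF n f →
      ∫ y, max (f y) 0 ≤ q * cN n → ∫ y, max (- f y) 0 ≤ q' * cN n →
      ∀ (x0 : EuclideanSpace ℝ (Fin n)) (R : ℝ), 0 < R →
      Real.exp (AP n f x0 R) * k * R ≤
        (∫ z in closedBall x0 R, Real.exp ((n:ℝ) * logPot n f z)) ^ ((1:ℝ) / n) ∧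
      (∫ z in closedBall x0 R, Real.exp ((n:ℝ) * logPot n f z)) ^ ((1:ℝ) / n) ≤
        Real.exp (AP n f x0 R) * K * R := by
  have hn' : (2:ℝ) ≤ n := by exact_mod_cast hn
  have hnp : (0:ℝ) < n := by linarith
  set σ : ℝ := n / (2 * q') with hσd
  have hσ : 0 < σ := by positivity
  obtain ⟨K1, hK1, up1⟩ := up_int hn (σ := n) (q := q) hnp.le hq (by nlinarith)
  obtain ⟨K2, hK2, up2⟩ := up_int hn (σ := σ) (q := q') hσ.le hq' (by
    rw [hσd]; field_simp; linarith)
  set v1 := (volume (closedBall (0 : EuclideanSpace ℝ (Fin n)) 1)).toReal with hv1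
  have hv1p : 0 < v1 := ENNReal.toReal_pos (measure_closedBall_pos _ _ one_pos).ne'
    (isCompact_closedBall _ _).measure_lt_top.ne
  set a := (2 * K2) ^ (-((n:ℝ) / σ)) with ha
  have hap : 0 < a := by positivity
  refine ⟨(a * (v1 / 2)) ^ ((1:ℝ)/n), (K1 * v1) ^ ((1:ℝ)/n), by positivity, by positivity, ?_⟩
  intro f hf hm hm' x0 R hR
  have hmeas := logPot_measurable hf
  set A := AP n f x0 R with hA
  have hBt : volume (closedBall x0 R) ≠ ∞ := (isCompact_closedBall _ _).measure_lt_top.ne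
  have hvol : (volume (closedBall x0 R)).toReal = R ^ (n:ℝ) * v1 := by
    rw [Measure.addHaar_closedBall' _ _ hR.le, ENNReal.toReal_mul,
      ENNReal.toReal_ofReal (by positivity)]
    simp [hv1]
  have root : ∀ b : ℝ, 0 < b → (Real.exp (n * A) * (b * R ^ (n:ℝ))) ^ ((1:ℝ)/n) =
      Real.exp A * b ^ ((1:ℝ)/n) * R := by
    intro b hb
    rw [Real.mul_rpow (by positivity) (by positivity), Real.mul_rpow (by positivity) (by positivity),
      ← Real.rpow_mul hR.le, ← Real.exp_mul, mul_one_div_cancel hnp.ne', Real.rpow_one]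
    have e : (n:ℝ) * A * (1 / n) = A := by field_simp
    rw [e]; ring
  obtain ⟨M, hM, hMb⟩ := pot_bdd hn hf hq hq1 hm x0 hR
  constructor
  · rw [← root _ (by positivity)]
    apply Real.rpow_le_rpow (by positivity) _ (by positivity)
    have hint : IntegrableOn (fun z => Real.exp ((n:ℝ) * logPot n f z)) (closedBall x0 R) := by
      apply Measure.integrableOn_of_bounded (M := M ^ n) hBt (by fun_prop)
      filter_upwards [ae_restrict_mem measurableSet_closedBall] with x hx
      rw [Real.norm_of_nonneg (Real.exp_pos _).le, Real.exp_nat_mul]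
      gcongr
      exact hMb x hx
    have u2 := up2 _ hf.neg hm' x0 R hR
    simp only [logPot_neg, AP_neg] at u2
    have mk := markovM volume (G := fun x => ENNReal.ofReal (Real.exp (σ * (-logPot n f x - -AP n f x0 R))))
      (by fun_prop) measurableSet_closedBall hK2 hBt u2
    have := real_int_ge volume (a := Real.exp (n * A) * a) (v := R ^ (n:ℝ) * v1 / 2) hint
      (fun x => (Real.exp_pos _).le) (by positivity) (by positivity)
      (P := closedBall x0 R ∩ {x | ENNReal.ofReal (Real.exp (σ * (-logPot n f x - -AP n f x0 R))) ≤
        ENNReal.ofReal (2 * K2)}) (by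
        rintro x ⟨hx, hx2⟩
        refine ⟨hx, ?_⟩
        simp only [mem_ofPred_eq] at hx2
        rw [ENNReal.ofReal_le_ofReal_iff (by positivity)] at hx2
        exact exp_lower hσ hnp.le hK2 hx2) (by
        refine le_trans (le_of_eq ?_) mk
        rw [← hvol, ENNReal.ofReal_div_of_pos (by norm_num), ENNReal.ofReal_toReal hBt]
        simp)
    refine le_trans (le_of_eq ?_) this
    ring
  · rw [← root _ (by positivity)]
    apply Real.rpow_le_rpow (integral_nonneg fun x => (Real.exp_pos _).le) _ (by positivity)
    have := real_int_le volume hmeas hK1 hBt (up1 f hf hm x0 R hR)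
    rw [hvol] at this
    refine this.trans (le_of_eq ?_)
    ring

lemma Ap_bounds {n : ℕ} (hn : 2 ≤ n) {q q' : ℝ} (hq : 0 < q) (hq1 : q < 1) (hq' : 0 < q') :
    ∃ K : ℝ, ∀ f : EuclideanSpace ℝ (Fin n) → ℝ, GoodF n f →
      ∫ y, max (f y) 0 ≤ q * cN n → ∫ y, max (- f y) 0 ≤ q' * cN n →
      IsApWeight n (1 + 2 * q') K (fun x => Real.exp ((n : ℝ) * logPot n f x)) := by
  have hn' : (2:ℝ) ≤ n := by exact_mod_cast hn
  have hnp : (0:ℝ) < n := by linarith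
  have : NeZero n := ⟨by omega⟩
  set σ : ℝ := n / (2 * q') with hσd
  have hσ : 0 < σ := by positivity
  obtain ⟨K1, hK1, up1⟩ := up_int hn (σ := n) (q := q) hnp.le hq (by nlinarith)
  obtain ⟨K2, hK2, up2⟩ := up_int hn (σ := σ) (q := q') hσ.le hq' (by
    rw [hσd]; field_simp; linarith)
  refine ⟨K1 * K2 ^ (2 * q'), ?_⟩
  intro f hf hm hm' x0 R hR
  have hmeas := logPot_measurable hf
  set A := AP n f x0 R with hA
  have hBt : volume (ball x0 R) ≠ ∞ := measure_ball_lt_top.ne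
  have hBp : 0 < (volume (ball x0 R)).toReal :=
    ENNReal.toReal_pos (measure_ball_pos _ _ hR).ne' hBt
  have hcb := Measure.addHaar_closedBall_eq_addHaar_ball volume x0 R
  have i1 := real_int_le volume hmeas hK1 hBt
    ((lintegral_mono_set ball_subset_closedBall).trans ((up1 f hf hm x0 R hR).trans_eq (by rw [hcb])))
  have u2 := up2 _ hf.neg hm' x0 R hR
  simp only [logPot_neg, AP_neg] at u2
  have i2 := real_int_le volume (g := fun x => - logPot n f x) hmeas.neg hK2 hBt
    ((lintegral_mono_set ball_subset_closedBall).trans (u2.trans_eq (by rw [hcb])))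
  have e2 : ∀ y, (Real.exp ((n:ℝ) * logPot n f y)) ^ (-(1 / (1 + 2 * q' - 1)) : ℝ) =
      Real.exp (σ * (- logPot n f y)) := by
    intro y
    rw [← Real.exp_mul, hσd]; congr 1; rw [add_sub_cancel_left]; field_simp
  simp only [e2]
  rw [add_sub_cancel_left]
  set V := (volume (ball x0 R)).toReal with hV
  have j1 : V⁻¹ * ∫ y in ball x0 R, Real.exp ((n:ℝ) * logPot n f y) ≤ Real.exp (n * A) * K1 := by
    rw [inv_mul_le_iff₀ hBp]; refine i1.trans (le_of_eq ?_); ring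
  have j2 : V⁻¹ * ∫ y in ball x0 R, Real.exp (σ * - logPot n f y) ≤ Real.exp (σ * -A) * K2 := by
    rw [inv_mul_le_iff₀ hBp]; refine i2.trans (le_of_eq ?_); ring
  have p2 : 0 ≤ V⁻¹ * ∫ y in ball x0 R, Real.exp (σ * - logPot n f y) :=
    mul_nonneg (by positivity) (integral_nonneg fun x => (Real.exp_pos _).le)
  calc _ ≤ (Real.exp (n * A) * K1) * (Real.exp (σ * -A) * K2) ^ (2 * q') := by
        gcongr
    _ = (Real.exp (n * A) * Real.exp (σ * -A) ^ (2 * q')) * (K1 * K2 ^ (2 * q')) := by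
        rw [Real.mul_rpow (by positivity) hK2.le]; ring
    _ = _ := by
        rw [← Real.exp_mul, ← Real.exp_add, hσd]
        have : n * A + n / (2 * q') * -A * (2 * q') = 0 := by field_simp; ring
        rw [this]; simp

lemma d_bounds {n : ℕ} (hn : 2 ≤ n) {q q' : ℝ} (hq : 0 < q) (hq1 : q < 1) (hq' : 0 < q') :
    ∃ k K : ℝ, 0 < k ∧ 0 < K ∧ ∀ f : EuclideanSpace ℝ (Fin n) → ℝ, GoodF n f →
      ∫ y, max (f y) 0 ≤ q * cN n → ∫ y, max (- f y) 0 ≤ q' * cN n →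
      ∀ (x y : EuclideanSpace ℝ (Fin n)) (R : ℝ), 0 < R → dist x y = 2 * R →
      Real.exp (AP n f (midpoint ℝ x y) R) * k * R ≤
        dW n (fun z => Real.exp ((n:ℝ) * logPot n f z)) x y ∧
      dW n (fun z => Real.exp ((n:ℝ) * logPot n f z)) x y ≤
        Real.exp (AP n f (midpoint ℝ x y) R) * K * R := by
  have hn' : (2:ℝ) ≤ n := by exact_mod_cast hn
  have hnp : (0:ℝ) < n := by linarith
  set σ : ℝ := 1 / (2 * q') with hσd
  have hσ : 0 < σ := by positivity
  obtain ⟨K1, hK1, up1⟩ := up_line hn (σ := 1) (q := q) zero_le_one hq (by linarith)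
  obtain ⟨K2, hK2, up2⟩ := up_line hn (σ := σ) (q := q') hσ.le hq' (by
    rw [hσd]; field_simp; norm_num)
  set a := (2 * K2) ^ (-(1 / σ)) with ha
  have hap : 0 < a := by positivity
  refine ⟨a, K1 * 2, by positivity, by positivity, ?_⟩
  intro f hf hm hm' x y R hR hxy
  have hmeas := logPot_measurable hf
  set x0 := midpoint ℝ x y with hx0
  set A := AP n f x0 R with hA
  obtain ⟨M, hM, hMb⟩ := pot_bdd hn hf hq hq1 hm x0 hR
  have hpow : ∀ z, (Real.exp ((n:ℝ) * logPot n f z)) ^ ((1:ℝ)/n) = Real.exp (logPot n f z) := by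
    intro z
    rw [← Real.exp_mul]; congr 1; field_simp
  have hR2 : dist x y / 2 = R := by rw [hxy]; ring
  unfold dW
  simp only [hpow, hR2, ← hx0]
  -- direction
  set e := (2 * R)⁻¹ • (y - x) with he
  have hnorm : ‖y - x‖ = 2 * R := by rw [← hxy, dist_comm, dist_eq_norm]
  have he1 : ‖e‖ = 1 := by
    rw [he, norm_smul, hnorm, Real.norm_of_nonneg (by positivity)]
    field_simp
  have hey : (2 * R) • e = y - x := by
    rw [he, smul_smul, mul_inv_cancel₀ (by positivity), one_smul]
  have hee : inner ℝ e e = (1:ℝ) := by rw [real_inner_self_eq_norm_sq, he1]; norm_num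
  have hey2 : inner ℝ e (y - x) = 2 * R := by
    rw [← hey, inner_smul_right, hee]; ring
  have hx0' : x0 = x + R • e := by
    have h2 : R • e = (2⁻¹ : ℝ) • (y - x) := by
      rw [he, smul_smul]; congr 1; field_simp
    rw [hx0, midpoint_eq_smul_add, invOf_eq_inv, h2]
    module
  -- lower bound for each curve
  have lower : ∀ d ∈ {d : ℝ | ∃ (L : ℝ) (γ : ℝ → EuclideanSpace ℝ (Fin n)),
      0 ≤ L ∧ LipschitzOnWith 1 γ (Set.Icc 0 L) ∧ γ 0 = x ∧ γ L = y ∧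
      (∀ t ∈ Set.Icc 0 L, γ t ∈ closedBall x0 R) ∧
      d = ∫ t in (0 : ℝ)..L, Real.exp (logPot n f (γ t))}, Real.exp A * a * R ≤ d := by
    rintro d ⟨L, γ, hL, hLip, h0, h1, hball, rfl⟩
    obtain ⟨G, hGm, hGi, hG⟩ := up2 _ hf.neg hm' x0 R hR x e he1
    simp only [logPot_neg, AP_neg] at hG
    have hvI : volume (Icc 0 (2 * R)) = ENNReal.ofReal (2 * R) := by simp
    have mk := markovM volume hGm measurableSet_Icc hK2 (by rw [hvI]; exact ENNReal.ofReal_ne_top) hGi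
    set S := Icc 0 (2 * R) ∩ {t | G t ≤ ENNReal.ofReal (2 * K2)} with hS
    have hSv : ENNReal.ofReal R ≤ volume S := by
      refine le_trans (le_of_eq ?_) mk
      rw [hvI, ENNReal.ofReal_mul (by norm_num), ENNReal.ofReal_ofNat, mul_comm,
        ENNReal.mul_div_cancel_right (by norm_num) (by norm_num)]
    set h : ℝ → ℝ := fun t => inner ℝ e (γ t - x) with hh
    have hhLip : LipschitzOnWith 1 h (Icc 0 L) := by
      apply LipschitzOnWith.of_dist_le_mul
      intro s hs t ht
      have := hLip.dist_le_mul s hs t ht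
      refine le_trans ?_ this
      rw [hh, Real.dist_eq, ← inner_sub_right, dist_eq_norm]
      refine (abs_real_inner_le_norm _ _).trans ?_
      rw [he1, one_mul]
      apply le_of_eq; congr 1; abel
    set P := Icc 0 L ∩ h ⁻¹' S with hP
    have hSP : S ⊆ h '' P := by
      intro s hs
      have hiv := intermediate_value_Icc hL hhLip.continuousOn
      have e0 : h 0 = 0 := by simp [hh, h0]
      have e1 : h L = 2 * R := by simp only [hh, h1]; exact hey2
      rw [e0, e1] at hiv
      obtain ⟨t, ht, hts⟩ := hiv hs.1
      exact ⟨t, ⟨ht, by rw [mem_preimage, hts]; exact hs⟩, hts⟩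
    have hPv : volume S ≤ volume P := by
      refine (measure_mono hSP).trans ?_
      have := (hhLip.mono (inter_subset_left : P ⊆ Icc 0 L)).hausdorffMeasure_image_le (d := 1) zero_le_one
      simpa [hausdorffMeasure_real] using this
    have hγm : AEMeasurable γ (volume.restrict (Icc 0 L)) :=
      hLip.continuousOn.aemeasurable measurableSet_Icc
    have hint : IntegrableOn (fun t => Real.exp (logPot n f (γ t))) (Icc 0 L) := by
      refine ⟨?_, ?_⟩
      · exact ((Real.measurable_exp.comp hmeas).comp_aemeasurable hγm).aestronglyMeasurable
      · apply HasFiniteIntegral.of_bounded (C := M)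
        filter_upwards [ae_restrict_mem measurableSet_Icc] with t ht
        rw [Real.norm_of_nonneg (Real.exp_pos _).le]
        exact hMb _ (hball t ht)
    have := real_int_ge volume (a := Real.exp A * a) (v := R) (P := P) hint
      (fun t => (Real.exp_pos _).le) (by positivity) hR.le (by
        rintro t ⟨ht, hts⟩
        refine ⟨ht, ?_⟩
        have g1 := (hG (γ t) (hball t ht)).trans hts.2
        rw [ENNReal.ofReal_le_ofReal_iff (by positivity)] at g1
        have := exp_lower (m := 1) hσ zero_le_one hK2 g1
        rw [one_mul, one_mul] at this
        exact this) (hSv.trans hPv)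
    rw [intervalIntegral.integral_of_le hL, ← integral_Icc_eq_integral_Ioc]
    exact this
  -- the segment
  have seg : (∫ t in (0:ℝ)..(2 * R), Real.exp (logPot n f (x + t • e))) ∈
      {d : ℝ | ∃ (L : ℝ) (γ : ℝ → EuclideanSpace ℝ (Fin n)),
      0 ≤ L ∧ LipschitzOnWith 1 γ (Set.Icc 0 L) ∧ γ 0 = x ∧ γ L = y ∧
      (∀ t ∈ Set.Icc 0 L, γ t ∈ closedBall x0 R) ∧
      d = ∫ t in (0 : ℝ)..L, Real.exp (logPot n f (γ t))} := by
    refine ⟨2 * R, fun t => x + t • e, by positivity, ?_, by simp, ?_, ?_, rfl⟩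
    · apply LipschitzOnWith.of_dist_le_mul
      intro s hs t ht
      rw [dist_add_left, dist_eq_norm, ← sub_smul, norm_smul, he1, Real.dist_eq]
      simp
    · simp only [hey]; abel
    · intro t ht
      rw [mem_closedBall, hx0', dist_add_left, dist_eq_norm, ← sub_smul, norm_smul, he1, mul_one,
        Real.norm_eq_abs, abs_le]
      constructor <;> linarith [ht.1, ht.2]
  have segball : ∀ t ∈ Icc 0 (2 * R), x + t • e ∈ closedBall x0 R := by
    intro t ht
    rw [mem_closedBall, hx0', dist_add_left, dist_eq_norm, ← sub_smul, norm_smul, he1, mul_one,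
        Real.norm_eq_abs, abs_le]
    constructor <;> linarith [ht.1, ht.2]
  constructor
  · exact le_csInf ⟨_, seg⟩ lower
  · refine (csInf_le ⟨_, lower⟩ seg).trans ?_
    obtain ⟨G, hGm, hGi, hG⟩ := up1 _ hf hm x0 R hR x e he1
    rw [intervalIntegral.integral_of_le (by positivity), ← integral_Icc_eq_integral_Ioc]
    have hvI : volume (Icc 0 (2 * R)) = ENNReal.ofReal (2 * R) := by simp
    have := real_int_le (volume : Measure ℝ) (g := fun t => logPot n f (x + t • e)) (σ := 1) (A := A)
      (B := Icc 0 (2 * R)) (K := K1) (by fun_prop) hK1 (by rw [hvI]; exact ENNReal.ofReal_ne_top) (by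
        refine le_trans ?_ hGi
        apply setLIntegral_mono' measurableSet_Icc
        intro t ht
        have g := hG _ (segball t ht)
        rwa [add_sub_cancel_left, inner_smul_right, hee, mul_one] at g)
    simp only [one_mul] at this
    refine this.trans (le_of_eq ?_)
    rw [hvI, ENNReal.toReal_ofReal (by positivity)]
    ring

/-- If `u` is the normal logarithmic potential of `f` with
`α = ∫ f⁺ < c_n` and `β = ∫ f⁻ < ∞`, then `ω = e^{nu}` is a strong `A_∞` weight,
with `A_p` data and comparability constant depending only on `n`, `α`, `β`. -/
theorem strongAinfty_of_logPotential
    (n : ℕ) (hn : 2 ≤ n) (α β : ℝ) (hα : α < cN n) :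
    ∃ p K C : ℝ, 1 < p ∧ 0 < C ∧
      ∀ f : EuclideanSpace ℝ (Fin n) → ℝ,
        Continuous f →
        Integrable f →
        (∀ x : EuclideanSpace ℝ (Fin n),
          Integrable (fun y => Real.log (‖y‖ / ‖x - y‖) * f y)) →
        (∫ y, max (f y) 0) = α →
        (∫ y, max (-f y) 0) = β →
        IsApWeight n p K (fun x => Real.exp ((n : ℝ) * logPot n f x)) ∧
        ∀ x y : EuclideanSpace ℝ (Fin n),
          C⁻¹ * deltaW n (fun z => Real.exp ((n : ℝ) * logPot n f z)) x y ≤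
              dW n (fun z => Real.exp ((n : ℝ) * logPot n f z)) x y ∧
          dW n (fun z => Real.exp ((n : ℝ) * logPot n f z)) x y ≤
              C * deltaW n (fun z => Real.exp ((n : ℝ) * logPot n f z)) x y := by
  have hc := cN_pos n hn
  have hnp : (0:ℝ) < n := by positivity
  set q : ℝ := (max (α / cN n) 0 + 1) / 2 with hqd
  have hα1 : α / cN n < 1 := (div_lt_one hc).2 hα
  have hmax : max (α / cN n) 0 < 1 := max_lt hα1 one_pos
  have hq : 0 < q := by
    have := le_max_right (α / cN n) 0
    linarith
  have hq1 : q < 1 := by linarith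
  have hqα : α ≤ q * cN n := by
    rw [← div_le_iff₀ hc]
    have := le_max_left (α / cN n) 0
    linarith
  set q' : ℝ := |β / cN n| + 1 with hqd'
  have hq' : 0 < q' := by positivity
  have hqβ : β ≤ q' * cN n := by
    rw [← div_le_iff₀ hc]
    have := le_abs_self (β / cN n)
    linarith
  obtain ⟨K, hAp⟩ := Ap_bounds hn hq hq1 hq'
  obtain ⟨k1, K1, hk1, hK1, hδ⟩ := delta_bounds hn hq hq1 hq'
  obtain ⟨k2, K2, hk2, hK2, hd⟩ := d_bounds hn hq hq1 hq'
  refine ⟨1 + 2 * q', K, K1 / k2 + K2 / k1, by linarith, by positivity, ?_⟩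
  intro f hcont hint hlog hfα hfβ
  have hf : GoodF n f := ⟨hcont, hint, hlog⟩
  have hm : ∫ y, max (f y) 0 ≤ q * cN n := by rw [hfα]; exact hqα
  have hm' : ∫ y, max (- f y) 0 ≤ q' * cN n := by rw [hfβ]; exact hqβ
  refine ⟨hAp f hf hm hm', fun x y => ?_⟩
  have : NeZero n := ⟨by omega⟩
  by_cases hxy : x = y
  · subst hxy
    have d0 : deltaW n (fun z => Real.exp ((n : ℝ) * logPot n f z)) x x = 0 := by
      unfold deltaW
      rw [dist_self, zero_div, closedBall_zero, Measure.restrict_singleton]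
      have : ((n:ℝ))⁻¹ ≠ 0 := by positivity
      simp [Real.zero_rpow this]
    have d1 : dW n (fun z => Real.exp ((n : ℝ) * logPot n f z)) x x = 0 := by
      unfold dW
      have hlow : ∀ d ∈ {d : ℝ | ∃ (L : ℝ) (γ : ℝ → EuclideanSpace ℝ (Fin n)),
          0 ≤ L ∧ LipschitzOnWith 1 γ (Set.Icc 0 L) ∧ γ 0 = x ∧ γ L = x ∧
          (∀ t ∈ Set.Icc 0 L, γ t ∈ closedBall (midpoint ℝ x x) (dist x x / 2)) ∧
          d = ∫ t in (0 : ℝ)..L, (Real.exp ((n : ℝ) * logPot n f (γ t))) ^ ((1 : ℝ) / n)}, 0 ≤ d := by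
        rintro d ⟨L, γ, hL, -, -, -, -, rfl⟩
        exact intervalIntegral.integral_nonneg hL fun t _ => by positivity
      have hmem : (0:ℝ) ∈ {d : ℝ | ∃ (L : ℝ) (γ : ℝ → EuclideanSpace ℝ (Fin n)),
          0 ≤ L ∧ LipschitzOnWith 1 γ (Set.Icc 0 L) ∧ γ 0 = x ∧ γ L = x ∧
          (∀ t ∈ Set.Icc 0 L, γ t ∈ closedBall (midpoint ℝ x x) (dist x x / 2)) ∧
          d = ∫ t in (0 : ℝ)..L, (Real.exp ((n : ℝ) * logPot n f (γ t))) ^ ((1 : ℝ) / n)} := by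
        refine ⟨0, fun _ => x, le_rfl, ?_, rfl, rfl, ?_, by simp⟩
        · exact (LipschitzWith.const' x).lipschitzOnWith
        · intro t _; simp
      exact le_antisymm (csInf_le ⟨0, hlow⟩ hmem) (le_csInf ⟨0, hmem⟩ hlow)
    rw [d0, d1]; simp
  · have hdist : 0 < dist x y := dist_pos.2 hxy
    set R := dist x y / 2 with hR
    have hRp : 0 < R := by positivity
    obtain ⟨a1, a2⟩ := hδ f hf hm hm' (midpoint ℝ x y) R hRp
    obtain ⟨b1, b2⟩ := hd f hf hm hm' x y R hRp (by rw [hR]; ring)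
    have hdel : deltaW n (fun z => Real.exp ((n : ℝ) * logPot n f z)) x y =
      (∫ z in closedBall (midpoint ℝ x y) R, Real.exp ((n:ℝ) * logPot n f z)) ^ ((1:ℝ) / n) := rfl
    rw [← hdel] at a1 a2
    set δ := deltaW n (fun z => Real.exp ((n : ℝ) * logPot n f z)) x y
    set d := dW n (fun z => Real.exp ((n : ℝ) * logPot n f z)) x y
    set t := Real.exp (AP n f (midpoint ℝ x y) R) * R with ht
    have htp : 0 < t := by positivity
    have a1 : k1 * t ≤ δ := le_trans (le_of_eq (by rw [ht]; ring)) a1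
    have a2 : δ ≤ K1 * t := a2.trans (le_of_eq (by rw [ht]; ring))
    have b1 : k2 * t ≤ d := le_trans (le_of_eq (by rw [ht]; ring)) b1
    have b2 : d ≤ K2 * t := b2.trans (le_of_eq (by rw [ht]; ring))
    have hd0 : 0 ≤ d := le_trans (by positivity) b1
    have hδ0 : 0 ≤ δ := le_trans (by positivity) a1
    constructor
    · rw [inv_mul_le_iff₀ (by positivity)]
      calc δ ≤ K1 * t := a2
        _ = K1 / k2 * (k2 * t) := by field_simp
        _ ≤ K1 / k2 * d := by gcongr
        _ ≤ (K1 / k2 + K2 / k1) * d := by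
            gcongr
            have : 0 < K2 / k1 := by positivity
            linarith
    · calc d ≤ K2 * t := b2
        _ = K2 / k1 * (k1 * t) := by field_simp
        _ ≤ K2 / k1 * δ := by gcongr
        _ ≤ (K1 / k2 + K2 / k1) * δ := by
            gcongr
            have : 0 < K1 / k2 := by positivity
            linarith
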